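/- Let k ≥ 5 be an integer, λ₁,…,λ₇ positive real numbers, and ε > 0. There is a constant C such that for all sufficiently large X and all τ with 0 < τ < 1: with R = τ^{−2} X^{(5k−12)/(32k)} (log X)³, one has ∫_{|α| ≥ R} |S₂(λ₁α, ρ) S₃(λ₂α) S₃(λ₃α) S₃(λ₄α) S₃(λ₅α) S₄(λ₆α) S_k(λ₇α)| K_τ(α) dα ≤ C R^{−1} X^{13/12 + 5/32 + 5/(8k) + ε}. -/

import Mathlib

open MeasureTheory Finset
open scoped Classical

/-- `e(x) = exp(2πix)`. -/
noncomputable def e (x : ℝ) : ℂ := Complex.exp (2 * Real.pi * Complex.I * x)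

/-- Fejér-type kernel `K_τ(α)`. -/
noncomputable def Kf (τ α : ℝ) : ℝ :=
  if α = 0 then τ ^ 2 else (Real.sin (Real.pi * τ * α) / (Real.pi * α)) ^ 2

/-- `ψ(m,z) = 1` if every prime factor of `m` is `≥ z`, else `0`. -/
noncomputable def psi (m : ℕ) (z : ℝ) : ℝ :=
  if ∀ p : ℕ, p.Prime → p ∣ m → z ≤ (p : ℝ) then 1 else 0

/-- `z(p)` in the sieve weights. -/
noncomputable def zP (X : ℝ) (p : ℕ) : ℝ :=
  if (p : ℝ) < X ^ ((1:ℝ)/7) then X ^ ((5:ℝ)/28) * (p : ℝ) ^ (-(1:ℝ)/2)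
  else if (p : ℝ) ≤ X ^ ((3:ℝ)/14) then (p : ℝ)
  else X ^ ((5:ℝ)/14) / (p : ℝ)

/-- The sieve function `ρ(m)` of Harman–Kumchev. -/
noncomputable def rho (X : ℝ) (m : ℕ) : ℝ :=
  psi m (X ^ ((5:ℝ)/42)) -
    ∑ p ∈ m.primeFactors.filter
        (fun p : ℕ => X ^ ((5:ℝ)/42) ≤ (p:ℝ) ∧ (p:ℝ) ≤ X ^ ((1:ℝ)/4)),
      psi (m / p) (zP X p)

/-- `S_k(α) = Σ_{p ∈ [(ηX)^{1/k}, X^{1/k}]} (log p) e(p^k α)`, sum over primes. -/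
noncomputable def SS (η X : ℝ) (k : ℕ) (α : ℝ) : ℂ :=
  ∑ p ∈ (Finset.Icc 1 ⌊X ^ ((1:ℝ)/(k:ℝ))⌋₊).filter
      (fun p : ℕ => p.Prime ∧ (η * X) ^ ((1:ℝ)/(k:ℝ)) ≤ (p : ℝ)),
    (Real.log p : ℂ) * e ((p : ℝ) ^ k * α)

/-- `S₂(α, ρ) = Σ_{m ∈ [(ηX)^{1/2}, X^{1/2}]} ρ(m) e(m²α)`. -/
noncomputable def S2 (η X α : ℝ) : ℂ :=
  ∑ m ∈ (Finset.Icc 1 ⌊X ^ ((1:ℝ)/2)⌋₊).filter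
      (fun m : ℕ => (η * X) ^ ((1:ℝ)/2) ≤ (m : ℝ)),
    (rho X m : ℂ) * e ((m : ℝ) ^ 2 * α)

/-- `S_r(α)` for real `r ≥ 1`. -/
noncomputable def Sr (η X r α : ℝ) : ℂ :=
  ∑ p ∈ (Finset.Icc 1 ⌊X ^ (1/r)⌋₊).filter
      (fun p : ℕ => p.Prime ∧ (η * X) ^ (1/r) ≤ (p : ℝ)),
    (Real.log p : ℂ) * e ((p : ℝ) ^ r * α)

/-- `U_r(α)` for real `r ≥ 1`. -/
noncomputable def Ur (η X r α : ℝ) : ℂ :=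
  ∑ n ∈ (Finset.Icc 1 ⌊X ^ (1/r)⌋₊).filter
      (fun n : ℕ => (η * X) ^ (1/r) ≤ (n : ℝ)),
    e ((n : ℝ) ^ r * α)

/-- Chebyshev's function `θ(x) = Σ_{p ≤ x} log p`. -/
noncomputable def theta (x : ℝ) : ℝ :=
  ∑ p ∈ (Finset.Icc 1 ⌊x⌋₊).filter Nat.Prime, Real.log p

/-- `J_r(X,h)`. -/
noncomputable def J (ε r X h : ℝ) : ℝ :=
  ∫ x in Set.Icc (ε * X) X,
    (theta ((x + h) ^ (1/r)) - theta (x ^ (1/r)) - ((x + h) ^ (1/r) - x ^ (1/r))) ^ 2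

/-- `T_n(α) = ∫_{(ηX)^{1/n}}^{X^{1/n}} e(t^n α) dt`. -/
noncomputable def T (η X : ℝ) (n : ℕ) (α : ℝ) : ℂ :=
  ∫ t in Set.Icc ((η * X) ^ ((1:ℝ)/(n:ℝ))) (X ^ ((1:ℝ)/(n:ℝ))), e (t ^ n * α)

/-- `m₁(k)`. -/
noncomputable def m1 (k : ℕ) : ℝ :=
  if k = 5 then 2 * (⌈343 * (k:ℝ) / 50 - 20⌉ : ℝ)
  else 2 * (⌈(49 * (k:ℝ) / 50 - (⌊49 * (k:ℝ) / 50⌋ : ℝ) / 2)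
      * ((⌊49 * (k:ℝ) / 50⌋ : ℝ) + 1)⌉ : ℝ)

/-- `σ(k) = 44/45 − 24/(25 m₁(k))`. -/
noncomputable def sigma' (k : ℕ) : ℝ := 44/45 - 24 / (25 * m1 k)

/-- `m(k)` depending on `δ`. -/
noncomputable def mδ (k : ℕ) (δ : ℝ) : ℝ :=
  if ⌊(k:ℝ) * δ⌋ ≤ 3 then
    2 * (⌈((k:ℝ) * δ + 1 - (⌊(k:ℝ) * δ⌋ : ℝ)) * (2:ℝ) ^ (⌊(k:ℝ) * δ - 1⌋)⌉ : ℝ)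
  else if ⌊(k:ℝ) * δ⌋ = 4 then 2 * (⌈7 * (k:ℝ) * δ - 20⌉ : ℝ)
  else 2 * (⌈((k:ℝ) * δ - (⌊(k:ℝ) * δ⌋ : ℝ)/2) * ((⌊(k:ℝ) * δ⌋ : ℝ) + 1)⌉ : ℝ)

/-- `m₂(k)`. -/
noncomputable def m2 (k : ℕ) : ℝ :=
  if k = 5 then
    2 * (⌈(2 * (k:ℝ)/3 + 1 - (⌊2 * (k:ℝ)/3⌋ : ℝ)) * (2:ℝ) ^ (⌊2 * (k:ℝ)/3⌋ - 1)⌉ : ℝ)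
  else if k ≤ 7 then 2 * (⌈14 * (k:ℝ)/3 - 20⌉ : ℝ)
  else 2 * (⌈(2 * (k:ℝ)/3 - (⌊2 * (k:ℝ)/3⌋ : ℝ)/2) * ((⌊2 * (k:ℝ)/3⌋ : ℝ) + 1)⌉ : ℝ)


lemma div_bound (ε : ℝ) (hε : 0 < ε) : ∃ C : ℝ, 1 ≤ C ∧ ∀ n : ℕ, n ≠ 0 →
    (n.divisors.card : ℝ) ≤ C * (n : ℝ) ^ ε := by
  have hl2 : 0 < Real.log 2 := Real.log_pos (by norm_num)
  set c : ℝ := 1 + 1 / (ε * Real.log 2) with hc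
  have hc1 : 1 ≤ c := by
    have : 0 < 1 / (ε * Real.log 2) := by positivity
    linarith
  set B : ℝ := (2:ℝ) ^ (1/ε) with hB
  refine ⟨c ^ ⌈B⌉₊, one_le_pow₀ hc1, fun n hn => ?_⟩
  have key : ∀ p : ℕ, p.Prime → ∀ a : ℕ,
      ((a:ℝ) + 1) ≤ (if (p:ℝ) < B then c else 1) * ((p:ℝ) ^ a) ^ ε := by
    intro p hp a
    have hp2 : (2:ℝ) ≤ p := by exact_mod_cast hp.two_le
    have hcomm : ((p:ℝ) ^ a) ^ ε = ((p:ℝ) ^ ε) ^ a := by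
      rw [← Real.rpow_natCast, ← Real.rpow_natCast, ← Real.rpow_mul (by positivity),
        ← Real.rpow_mul (by positivity), mul_comm]
    rw [hcomm]
    split_ifs with h
    · have h1 : (2:ℝ) ^ ε ≤ (p:ℝ) ^ ε := Real.rpow_le_rpow (by norm_num) hp2 hε.le
      have h2 : ((2:ℝ) ^ ε) ^ a ≤ ((p:ℝ) ^ ε) ^ a := pow_le_pow_left₀ (by positivity) h1 a
      have h3 : 1 + (a:ℝ) * (ε * Real.log 2) ≤ ((2:ℝ) ^ ε) ^ a := by
        have : ((2:ℝ) ^ ε) ^ a = Real.exp ((a:ℝ) * (ε * Real.log 2)) := by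
          rw [Real.exp_nat_mul, Real.rpow_def_of_pos (by norm_num), mul_comm ε]
        rw [this]
        have := Real.add_one_le_exp ((a:ℝ) * (ε * Real.log 2))
        linarith
      calc (a:ℝ) + 1 ≤ c * (1 + (a:ℝ) * (ε * Real.log 2)) := by
            have e1 : c * (1 + (a:ℝ) * (ε * Real.log 2))
              = 1 + a + a * (ε * Real.log 2) + 1 / (ε * Real.log 2) := by
              rw [hc]; field_simp; ring
            rw [e1]
            have : 0 < 1 / (ε * Real.log 2) := by positivity
            have : 0 ≤ a * (ε * Real.log 2) := by positivity
            linarith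
        _ ≤ _ := by
            apply mul_le_mul_of_nonneg_left (h3.trans h2) (by linarith)
    · rw [one_mul]
      push Not at h
      have h1 : (2:ℝ) ≤ (p:ℝ) ^ ε := by
        calc (2:ℝ) = B ^ ε := by
              rw [hB, ← Real.rpow_mul (by norm_num)]; field_simp; simp
          _ ≤ _ := Real.rpow_le_rpow (by positivity) h hε.le
      calc (a:ℝ) + 1 ≤ 2 ^ a := by
            exact_mod_cast Nat.lt_two_pow_self (n := a)
        _ ≤ _ := pow_le_pow_left₀ (by norm_num) h1 a
  have hn' : (n:ℝ) ^ ε = ∏ p ∈ n.primeFactors, ((p:ℝ) ^ (n.factorization p)) ^ ε := by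
    conv_lhs => rw [← Nat.prod_factorization_pow_eq_self hn]
    rw [Finsupp.prod, Nat.cast_prod, ← Real.finsetProd_rpow]
    · simp
    · intros; positivity
  rw [Nat.card_divisors hn, hn']
  push_cast
  calc ∏ p ∈ n.primeFactors, ((n.factorization p : ℝ) + 1)
      ≤ ∏ p ∈ n.primeFactors, ((if (p:ℝ) < B then c else 1)
        * ((p:ℝ) ^ (n.factorization p)) ^ ε) := by
        apply Finset.prod_le_prod
        · intros; positivity
        · intro p hp
          exact key p (Nat.prime_of_mem_primeFactors hp) _
    _ = (∏ p ∈ n.primeFactors, (if (p:ℝ) < B then c else 1)) *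
        ∏ p ∈ n.primeFactors, ((p:ℝ) ^ (n.factorization p)) ^ ε := Finset.prod_mul_distrib
    _ ≤ _ := by
        apply mul_le_mul_of_nonneg_right _ (Finset.prod_nonneg (by intros; positivity))
        rw [Finset.prod_ite]
        simp only [prod_const, one_pow, mul_one]
        apply pow_le_pow_right₀ hc1
        calc _ ≤ (Finset.range ⌈B⌉₊).card := by
              apply Finset.card_le_card
              intro p hp
              simp only [Finset.mem_filter] at hp
              simp only [Finset.mem_range]
              exact Nat.lt_ceil.mpr hp.2
          _ = _ := Finset.card_range _

lemma sd_pos (k : ℕ) (hk : 2 ≤ k) (x h l : ℤ) (hx : 0 ≤ x) (hh : 0 < h) (hl : 0 < l) :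
    0 < (x+h+l)^k - (x+h)^k - (x+l)^k + x^k := by
  induction k, hk using Nat.le_induction with
  | base =>
    have : (x+h+l)^2 - (x+h)^2 - (x+l)^2 + x^2 = 2*(h*l) := by ring
    rw [this]; positivity
  | succ k hk ih =>
    have : (x+h+l)^(k+1) - (x+h)^(k+1) - (x+l)^(k+1) + x^(k+1)
      = x * ((x+h+l)^k - (x+h)^k - (x+l)^k + x^k) + h * ((x+h+l)^k - (x+h)^k)
        + l * ((x+h+l)^k - (x+l)^k) := by ring
    rw [this]
    have a1 : (x+h)^k < (x+h+l)^k := pow_lt_pow_left₀ (by linarith) (by linarith) (by omega)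
    have a2 : (x+l)^k < (x+h+l)^k := pow_lt_pow_left₀ (by linarith) (by linarith) (by omega)
    have b1 : 0 < h * ((x+h+l)^k - (x+h)^k) := mul_pos hh (by linarith)
    have b2 : 0 < l * ((x+h+l)^k - (x+l)^k) := mul_pos hl (by linarith)
    have b3 : 0 ≤ x * ((x+h+l)^k - (x+h)^k - (x+l)^k + x^k) := mul_nonneg hx ih.le
    linarith

lemma td_aux (k : ℕ) (hk : 2 ≤ k) (x h l m : ℤ) (hx : 0 ≤ x) (hh : 0 < h) (hl : 0 < l)
    (hm : 0 < m)
    (ih : 0 ≤ ((x+m+h+l)^k - (x+m+h)^k - (x+m+l)^k + (x+m)^k)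
      - ((x+h+l)^k - (x+h)^k - (x+l)^k + x^k)) :
    0 < ((x+m+h+l)^(k+1) - (x+m+h)^(k+1) - (x+m+l)^(k+1) + (x+m)^(k+1))
      - ((x+h+l)^(k+1) - (x+h)^(k+1) - (x+l)^(k+1) + x^(k+1)) := by
  have : ((x+m+h+l)^(k+1) - (x+m+h)^(k+1) - (x+m+l)^(k+1) + (x+m)^(k+1))
      - ((x+h+l)^(k+1) - (x+h)^(k+1) - (x+l)^(k+1) + x^(k+1))
    = m * ((x+m+h+l)^k - (x+m+h)^k - (x+m+l)^k + (x+m)^k)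
     + x * (((x+m+h+l)^k - (x+m+h)^k - (x+m+l)^k + (x+m)^k)
      - ((x+h+l)^k - (x+h)^k - (x+l)^k + x^k))
     + h * (((x+h)+m+l)^k - ((x+h)+m)^k - ((x+h)+l)^k + (x+h)^k)
     + l * (((x+l)+m+h)^k - ((x+l)+m)^k - ((x+l)+h)^k + (x+l)^k) := by ring
  rw [this]
  have a1 := mul_pos hm (sd_pos k hk (x+m) h l (by linarith) hh hl)
  have a2 := mul_pos hh (sd_pos k hk (x+h) m l (by linarith) hm hl)
  have a3 := mul_pos hl (sd_pos k hk (x+l) m h (by linarith) hm hh)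
  have a4 := mul_nonneg hx ih
  linarith

lemma td_nonneg (k : ℕ) (hk : 2 ≤ k) (x h l m : ℤ) (hx : 0 ≤ x) (hh : 0 < h) (hl : 0 < l)
    (hm : 0 < m) :
    0 ≤ ((x+m+h+l)^k - (x+m+h)^k - (x+m+l)^k + (x+m)^k)
      - ((x+h+l)^k - (x+h)^k - (x+l)^k + x^k) := by
  induction k, hk using Nat.le_induction with
  | base => apply le_of_eq; ring
  | succ k hk ih => exact (td_aux k hk x h l m hx hh hl hm ih).le

lemma td_pos (k : ℕ) (hk : 3 ≤ k) (x h l m : ℤ) (hx : 0 ≤ x) (hh : 0 < h) (hl : 0 < l)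
    (hm : 0 < m) :
    0 < ((x+m+h+l)^k - (x+m+h)^k - (x+m+l)^k + (x+m)^k)
      - ((x+h+l)^k - (x+h)^k - (x+l)^k + x^k) := by
  obtain ⟨j, rfl⟩ : ∃ j, k = j + 1 := ⟨k-1, by omega⟩
  exact td_aux j (by omega) x h l m hx hh hl hm (td_nonneg j (by omega) x h l m hx hh hl hm)

/-- injectivity of first difference, positive step -/
lemma fd_inj_pos (k : ℕ) (hk : 2 ≤ k) (x y h : ℤ) (hx : 0 ≤ x) (hy : 0 ≤ y) (hh : 0 < h)
    (he : (x+h)^k - x^k = (y+h)^k - y^k) : x = y := by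
  rcases lt_trichotomy x y with h' | h' | h'
  · have := sd_pos k hk x h (y-x) hx hh (by linarith)
    rw [show x+h+(y-x) = y+h by ring, show x+(y-x) = y by ring] at this
    linarith
  · exact h'
  · have := sd_pos k hk y h (x-y) hy hh (by linarith)
    rw [show y+h+(x-y) = x+h by ring, show y+(x-y) = x by ring] at this
    linarith

lemma fd_inj (k : ℕ) (hk : 2 ≤ k) (a b c d : ℤ) (ha : 0 ≤ a) (hb : 0 ≤ b) (hc : 0 ≤ c)
    (hd : 0 ≤ d) (hab : a ≠ b) (h : a - b = c - d) (he : a^k - b^k = c^k - d^k) :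
    a = c ∧ b = d := by
  rcases lt_or_gt_of_ne hab with h' | h'
  · have := fd_inj_pos k hk a c (b-a) ha hc (by linarith) (by
      rw [show a + (b-a) = b by ring, show c + (b-a) = d by linarith]; linarith)
    exact ⟨this, by linarith⟩
  · have := fd_inj_pos k hk b d (a-b) hb hd (by linarith) (by
      rw [show b + (a-b) = a by ring, show d + (a-b) = c by linarith]; linarith)
    exact ⟨by linarith, this⟩

lemma sdiff_inj_pos (k : ℕ) (hk : 3 ≤ k) (x y h l : ℤ) (hx : 0 ≤ x) (hy : 0 ≤ y) (hh : 0 < h)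
    (hl : 0 < l)
    (he : (x+h+l)^k - (x+h)^k - (x+l)^k + x^k = (y+h+l)^k - (y+h)^k - (y+l)^k + y^k) : x = y := by
  rcases lt_trichotomy x y with h' | h' | h'
  · have := td_pos k hk x h l (y-x) hx hh hl (by linarith)
    rw [show x+(y-x) = y by ring] at this
    linarith
  · exact h'
  · have := td_pos k hk y h l (x-y) hy hh hl (by linarith)
    rw [show y+(x-y) = x by ring] at this
    linarith

/-- injectivity for parallelograms `a - b = a' - b'` -/
lemma par_inj (k : ℕ) (hk : 3 ≤ k) (a b a' b' c d c' d' : ℤ)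
    (ha : 0 ≤ a) (hb : 0 ≤ b) (ha' : 0 ≤ a') (hb' : 0 ≤ b')
    (hc : 0 ≤ c) (hd : 0 ≤ d) (hc' : 0 ≤ c') (hd' : 0 ≤ d')
    (h1 : a - b = a' - b') (h2 : c - d = c' - d') (h3 : a - b = c - d) (h4 : a - a' = c - c')
    (hab : a ≠ b) (haa : a ≠ a')
    (he : a^k - b^k - a'^k + b'^k = c^k - d^k - c'^k + d'^k) : a = c := by
  rcases lt_or_gt_of_ne hab with h' | h' <;> rcases lt_or_gt_of_ne haa with h'' | h''
  · -- a smallest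
    exact sdiff_inj_pos k hk a c (b-a) (a'-a) ha hc (by linarith) (by linarith) (by
      rw [show a + (b-a) + (a'-a) = b' by linarith, show a + (b-a) = b by ring,
        show a + (a'-a) = a' by ring, show c + (b-a) + (a'-a) = d' by linarith,
        show c + (b-a) = d by linarith, show c + (a'-a) = c' by linarith]
      linarith)
  · -- a' smallest
    have := sdiff_inj_pos k hk a' c' (b-a) (a-a') ha' hc' (by linarith) (by linarith) (by
      rw [show a' + (b-a) + (a-a') = b by linarith, show a' + (b-a) = b' by linarith,
        show a' + (a-a') = a by ring, show c' + (b-a) + (a-a') = d by linarith,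
        show c' + (b-a) = d' by linarith, show c' + (a-a') = c by linarith]
      linarith)
    linarith
  · have := sdiff_inj_pos k hk b d (a-b) (a'-a) hb hd (by linarith) (by linarith) (by
      rw [show b + (a-b) + (a'-a) = a' by linarith, show b + (a-b) = a by linarith,
        show b + (a'-a) = b' by linarith, show d + (a-b) + (a'-a) = c' by linarith,
        show d + (a-b) = c by linarith, show d + (a'-a) = d' by linarith]
      linarith)
    linarith
  · have := sdiff_inj_pos k hk b' d' (a-b) (a-a') hb' hd' (by linarith) (by linarith) (by
      rw [show b' + (a-b) + (a-a') = a by linarith, show b' + (a-b) = a' by linarith,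
        show b' + (a-a') = b by linarith, show d' + (a-b) + (a-a') = c by linarith,
        show d' + (a-b) = c' by linarith, show d' + (a-a') = d by linarith]
      linarith)
    linarith

lemma par_ne (k : ℕ) (hk : 2 ≤ k) (a b a' b' : ℤ)
    (ha : 0 ≤ a) (hb : 0 ≤ b) (ha' : 0 ≤ a') (hb' : 0 ≤ b')
    (h1 : a - b = a' - b') (he : a^k - b^k - a'^k + b'^k = 0) : a = b ∨ a = a' := by
  by_contra hcon
  push Not at hcon
  have := fd_inj k hk a b a' b' ha hb ha' hb' hcon.1 h1 (by linarith)
  exact hcon.2 this.1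

lemma par_dvd (k : ℕ) (a b a' b' : ℤ) (h1 : a - b = a' - b') :
    (a - b) ∣ (a^k - b^k - a'^k + b'^k) ∧ (a - a') ∣ (a^k - b^k - a'^k + b'^k) := by
  constructor
  · have h2 := sub_dvd_pow_sub_pow a b k
    have h3 := sub_dvd_pow_sub_pow a' b' k
    rw [← h1] at h3
    have := dvd_sub h2 h3
    rwa [show a^k - b^k - a'^k + b'^k = a^k - b^k - (a'^k - b'^k) by ring]
  · have h2 := sub_dvd_pow_sub_pow a a' k
    have h3 := sub_dvd_pow_sub_pow b b' k
    rw [show b - b' = a - a' by linarith] at h3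
    have := dvd_sub h2 h3
    rwa [show a^k - b^k - a'^k + b'^k = a^k - a'^k - (b^k - b'^k) by ring]

lemma idiv_bound (δ : ℝ) (hδ : 0 < δ) (k : ℕ) (hk : 1 ≤ k) : ∃ C : ℝ, 1 ≤ C ∧ ∀ N : ℕ, 1 ≤ N →
    ∀ n : ℤ, n ≠ 0 → |n| ≤ 2 * (N:ℤ) ^ k → (n.divisors.card : ℝ) ≤ C * (N:ℝ) ^ δ := by
  have hk0 : (0:ℝ) < k := by exact_mod_cast hk
  obtain ⟨C, hC, h⟩ := div_bound (δ / k) (by positivity)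
  have h2 : (1:ℝ) ≤ 2 ^ (δ / k) := Real.one_le_rpow (by norm_num) (by positivity)
  refine ⟨2 * C * 2 ^ (δ / k), by nlinarith, fun N hN n hn hle => ?_⟩
  have h1 : n.divisors.card ≤ 2 * n.natAbs.divisors.card := by
    have : n.divisors ⊆ n.natAbs.divisors.image (fun d : ℕ => (d:ℤ))
        ∪ n.natAbs.divisors.image (fun d : ℕ => -(d:ℤ)) := by
      intro d hd
      have hd' := (Int.mem_divisors.mp hd).1
      have hmem : d.natAbs ∈ n.natAbs.divisors :=
        Nat.mem_divisors.mpr ⟨Int.natAbs_dvd_natAbs.mpr hd', by simpa using hn⟩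
      simp only [Finset.mem_union, Finset.mem_image]
      rcases Int.natAbs_eq d with h | h
      · left; exact ⟨_, hmem, h.symm⟩
      · right; exact ⟨_, hmem, h.symm⟩
    calc _ ≤ _ := Finset.card_le_card this
      _ ≤ _ := Finset.card_union_le _ _
      _ ≤ n.natAbs.divisors.card + n.natAbs.divisors.card :=
        add_le_add Finset.card_image_le Finset.card_image_le
      _ = _ := by ring
  have h3 := h n.natAbs (by simpa using hn)
  have h4 : ((n.natAbs : ℕ) : ℝ) ≤ 2 * (N:ℝ)^k := by
    have : ((n.natAbs : ℕ) : ℤ) ≤ 2 * (N:ℤ)^k := by rwa [Int.natCast_natAbs]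
    exact_mod_cast this
  have h5 : ((n.natAbs : ℕ) : ℝ) ^ (δ/k) ≤ 2 ^ (δ/k) * (N:ℝ) ^ δ := by
    calc _ ≤ (2 * (N:ℝ)^k) ^ (δ/k) := Real.rpow_le_rpow (by positivity) h4 (by positivity)
      _ = _ := by
        rw [Real.mul_rpow (by norm_num) (by positivity), ← Real.rpow_natCast,
          ← Real.rpow_mul (by positivity)]
        congr 2; field_simp
  have h1' : (n.divisors.card : ℝ) ≤ 2 * n.natAbs.divisors.card := by exact_mod_cast h1
  calc (n.divisors.card : ℝ) ≤ 2 * (C * (2 ^ (δ/k) * (N:ℝ) ^ δ)) := by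
        refine h1'.trans (mul_le_mul_of_nonneg_left (h3.trans ?_) (by norm_num))
        exact mul_le_mul_of_nonneg_left h5 (by linarith)
    _ = _ := by ring

/-- fourth-moment counting -/
lemma count4 (k : ℕ) (hk : 2 ≤ k) (δ : ℝ) (hδ : 0 < δ) : ∃ C : ℝ, 1 ≤ C ∧ ∀ N : ℕ, 1 ≤ N →
    (((((Icc 1 N) ×ˢ (Icc 1 N)) ×ˢ ((Icc 1 N) ×ˢ (Icc 1 N))).filter
      (fun q : (ℕ × ℕ) × (ℕ × ℕ) => (q.1.1:ℤ)^k + (q.1.2:ℤ)^k = (q.2.1:ℤ)^k + (q.2.2:ℤ)^k)).card : ℝ)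
      ≤ C * (N:ℝ) ^ (2 + δ) := by
  obtain ⟨C, hC, h⟩ := idiv_bound δ hδ k (by omega)
  refine ⟨C + 1, by linarith, fun N hN => ?_⟩
  have hN1 : (1:ℝ) ≤ N := by exact_mod_cast hN
  set I := Icc 1 N with hI
  set Q := ((I ×ˢ I) ×ˢ (I ×ˢ I)).filter
      (fun q : (ℕ × ℕ) × (ℕ × ℕ) => (q.1.1:ℤ)^k + (q.1.2:ℤ)^k = (q.2.1:ℤ)^k + (q.2.2:ℤ)^k) with hQ
  have hIN : ∀ x ∈ I, (x:ℤ)^k ≤ (N:ℤ)^k ∧ 0 ≤ (x:ℤ)^k := by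
    intro x hx
    have := (Finset.mem_Icc.mp hx).2
    exact ⟨pow_le_pow_left₀ (by positivity) (by exact_mod_cast this) _, by positivity⟩
  have hmaps : Set.MapsTo (fun q : (ℕ × ℕ) × (ℕ × ℕ) => (q.1.1, q.2.1)) (Q : Set _)
      ((I ×ˢ I : Finset (ℕ × ℕ)) : Set (ℕ × ℕ)) := by
    intro q hq
    have := (Finset.mem_filter.mp (Finset.mem_coe.mp hq)).1
    simp only [Finset.mem_product] at this
    simp [this]
  have hδ1 : (1:ℝ) ≤ (N:ℝ) ^ δ := Real.one_le_rpow hN1 hδ.le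
  rw [Finset.card_eq_sum_card_fiberwise hmaps]
  push_cast
  have hfib : ∀ u ∈ I ×ˢ I, (((Q.filter (fun q => (q.1.1, q.2.1) = u)).card : ℕ) : ℝ)
      ≤ C * (N:ℝ)^δ + if u.1 = u.2 then (N:ℝ) else 0 := by
    rintro ⟨x, y⟩ hu
    simp only [Finset.mem_product] at hu
    by_cases hxy : x = y
    · simp only [hxy, if_true]
      have : (Q.filter (fun q => (q.1.1, q.2.1) = (y, y))).card ≤ I.card := by
        apply Finset.card_le_card_of_injOn (fun q => q.1.2)
        · intro q hq
          have := (Finset.mem_filter.mp (Finset.mem_filter.mp (Finset.mem_coe.mp hq)).1).1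
          simp only [Finset.mem_product] at this
          exact this.1.2
        · rintro ⟨⟨a, b⟩, c, d⟩ hq ⟨⟨a', b'⟩, c', d'⟩ hq' he
          simp only [hQ, Finset.coe_filter, Finset.mem_filter, Set.mem_ofPred_eq, Prod.mk.injEq] at hq hq' he
          obtain ⟨⟨_, e1⟩, rfl, rfl⟩ := hq
          obtain ⟨⟨_, e2⟩, rfl, rfl⟩ := hq'
          subst he
          have : (d:ℤ)^k = (d':ℤ)^k := by linarith
          have : d = d' := by
            have h3 : d^k = d'^k := by exact_mod_cast this
            exact Nat.pow_left_injective (by omega : k ≠ 0) h3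
          rw [this]
      have h2 : I.card = N := by simp [hI]
      rw [h2] at this
      have : (((Q.filter (fun q => (q.1.1, q.2.1) = (y, y))).card : ℕ) : ℝ) ≤ N := by
        exact_mod_cast this
      have : 0 ≤ C * (N:ℝ)^δ := by positivity
      linarith
    · simp only [hxy, if_false, add_zero]
      have hne : (y:ℤ)^k - (x:ℤ)^k ≠ 0 := by
        intro h0
        have : (y:ℤ)^k = (x:ℤ)^k := by linarith
        have h3 : y^k = x^k := by exact_mod_cast this
        exact hxy (Nat.pow_left_injective (by omega : k ≠ 0) h3).symm
      have hle : |(y:ℤ)^k - (x:ℤ)^k| ≤ 2 * (N:ℤ)^k := by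
        have := hIN x hu.1
        have := hIN y hu.2
        rw [abs_le]; constructor <;> linarith
      refine le_trans ?_ (h N hN _ hne hle)
      apply Nat.cast_le.mpr
      apply Finset.card_le_card_of_injOn (fun q => (q.1.2:ℤ) - (q.2.2:ℤ))
      · rintro ⟨⟨a, b⟩, c, d⟩ hq
        simp only [hQ, Finset.coe_filter, Finset.mem_filter, Set.mem_ofPred_eq, Prod.mk.injEq] at hq
        obtain ⟨⟨_, e1⟩, rfl, rfl⟩ := hq
        simp only [Finset.mem_coe, Int.mem_divisors]
        refine ⟨?_, hne⟩
        have := sub_dvd_pow_sub_pow (b:ℤ) (d:ℤ) k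
        rwa [show (c:ℤ)^k - (a:ℤ)^k = (b:ℤ)^k - (d:ℤ)^k by linarith]
      · rintro ⟨⟨a, b⟩, c, d⟩ hq ⟨⟨a', b'⟩, c', d'⟩ hq' he
        simp only [hQ, Finset.coe_filter, Finset.mem_filter, Set.mem_ofPred_eq, Prod.mk.injEq] at hq hq' he
        obtain ⟨⟨_, e1⟩, rfl, rfl⟩ := hq
        obtain ⟨⟨_, e2⟩, rfl, rfl⟩ := hq'
        have hbd : (b:ℤ) ≠ d := by
          intro hbd; rw [hbd] at e1; apply hne; linarith
        have := fd_inj k hk b d b' d' (by positivity) (by positivity) (by positivity)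
          (by positivity) hbd he (by linarith)
        have h1 : b = b' := by exact_mod_cast this.1
        have h2 : d = d' := by exact_mod_cast this.2
        rw [h1, h2]
  calc _ ≤ ∑ u ∈ I ×ˢ I, (C * (N:ℝ)^δ + if u.1 = u.2 then (N:ℝ) else 0) :=
        Finset.sum_le_sum hfib
    _ = C * (N:ℝ)^δ * (N:ℝ)^2 + (N:ℝ)^2 := by
        rw [Finset.sum_add_distrib, Finset.sum_product (f := fun u : ℕ × ℕ => if u.1 = u.2 then (N:ℝ) else 0)]
        have : ∀ x ∈ I, ∑ y ∈ I, (if x = y then (N:ℝ) else 0) = N := by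
          intro x hx
          rw [Finset.sum_ite_eq, if_pos hx]
        rw [Finset.sum_congr rfl this]
        simp [hI]
        ring
    _ ≤ C * (N:ℝ)^δ * (N:ℝ)^2 + (N:ℝ)^δ * (N:ℝ)^2 := by
        have : (0:ℝ) ≤ (N:ℝ)^2 := by positivity
        nlinarith
    _ = _ := by
        rw [Real.rpow_add (by linarith)]
        norm_cast
        ring

/-- eighth-moment counting after one differencing step -/
lemma count8 (k : ℕ) (hk : 3 ≤ k) (δ : ℝ) (hδ : 0 < δ) : ∃ C : ℝ, 1 ≤ C ∧ ∀ N : ℕ, 1 ≤ N →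
    ((((((Icc 1 N) ×ˢ (Icc 1 N)) ×ˢ ((Icc 1 N) ×ˢ (Icc 1 N))) ×ˢ
      (((Icc 1 N) ×ˢ (Icc 1 N)) ×ˢ ((Icc 1 N) ×ˢ (Icc 1 N)))).filter
      (fun q : ((ℕ × ℕ) × (ℕ × ℕ)) × ((ℕ × ℕ) × (ℕ × ℕ)) =>
        ((q.1.1.1:ℤ) - (q.1.1.2:ℤ) = (q.2.1.1:ℤ) - (q.2.1.2:ℤ)) ∧
        ((q.1.1.1:ℤ)^k - (q.1.1.2:ℤ)^k) + ((q.1.2.1:ℤ)^k + (q.1.2.2:ℤ)^k)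
        = ((q.2.1.1:ℤ)^k - (q.2.1.2:ℤ)^k) + ((q.2.2.1:ℤ)^k + (q.2.2.2:ℤ)^k))).card : ℝ)
      ≤ C * (N:ℝ) ^ (4 + δ) := by
  obtain ⟨C, hC, h⟩ := idiv_bound (δ/2) (by positivity) k (by omega)
  obtain ⟨C4, hC4, h4⟩ := count4 k (by omega) δ hδ
  refine ⟨C^2 + 2 * C4, by nlinarith, fun N hN => ?_⟩
  have hN1 : (1:ℝ) ≤ N := by exact_mod_cast hN
  replace h4 := h4 N hN
  set I := Icc 1 N with hI
  have hIc : I.card = N := by simp [hI]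
  set Q := (((I ×ˢ I) ×ˢ (I ×ˢ I)) ×ˢ ((I ×ˢ I) ×ˢ (I ×ˢ I))).filter
      (fun q : ((ℕ × ℕ) × (ℕ × ℕ)) × ((ℕ × ℕ) × (ℕ × ℕ)) =>
        ((q.1.1.1:ℤ) - (q.1.1.2:ℤ) = (q.2.1.1:ℤ) - (q.2.1.2:ℤ)) ∧
        ((q.1.1.1:ℤ)^k - (q.1.1.2:ℤ)^k) + ((q.1.2.1:ℤ)^k + (q.1.2.2:ℤ)^k)
        = ((q.2.1.1:ℤ)^k - (q.2.1.2:ℤ)^k) + ((q.2.2.1:ℤ)^k + (q.2.2.2:ℤ)^k)) with hQ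
  have hIN : ∀ x ∈ I, (x:ℤ)^k ≤ (N:ℤ)^k ∧ 0 ≤ (x:ℤ)^k := by
    intro x hx
    have := (Finset.mem_Icc.mp hx).2
    exact ⟨pow_le_pow_left₀ (by positivity) (by exact_mod_cast this) _, by positivity⟩
  have hmaps : Set.MapsTo (fun q : ((ℕ × ℕ) × (ℕ × ℕ)) × ((ℕ × ℕ) × (ℕ × ℕ)) => (q.1.2, q.2.2))
      (Q : Set _) (((I ×ˢ I) ×ˢ (I ×ˢ I) : Finset ((ℕ × ℕ) × (ℕ × ℕ))) : Set _) := by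
    intro q hq
    have := (Finset.mem_filter.mp (Finset.mem_coe.mp hq)).1
    simp only [Finset.mem_product] at this
    simp [this]
  rw [Finset.card_eq_sum_card_fiberwise hmaps]
  push_cast
  have hfib : ∀ u ∈ (I ×ˢ I) ×ˢ (I ×ˢ I),
      (((Q.filter (fun q => (q.1.2, q.2.2) = u)).card : ℕ) : ℝ)
      ≤ (C * (N:ℝ)^(δ/2))^2 +
        if (u.1.1:ℤ)^k + (u.1.2:ℤ)^k = (u.2.1:ℤ)^k + (u.2.2:ℤ)^k then 2 * (N:ℝ)^2 else 0 := by
    rintro ⟨⟨y1, y2⟩, z1, z2⟩ hu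
    simp only [Finset.mem_product] at hu
    by_cases hn : (y1:ℤ)^k + (y2:ℤ)^k = (z1:ℤ)^k + (z2:ℤ)^k
    · simp only [hn, if_true]
      have : (Q.filter (fun q => (q.1.2, q.2.2) = ((y1,y2),(z1,z2)))).card
          ≤ ((Finset.univ : Finset Bool) ×ˢ (I ×ˢ I)).card := by
        apply Finset.card_le_card_of_injOn (fun q => if q.1.1.1 = q.1.1.2 then
          (true, (q.1.1.1, q.2.1.1)) else (false, (q.1.1.1, q.1.1.2)))
        · intro q hq
          have := (Finset.mem_filter.mp (Finset.mem_filter.mp (Finset.mem_coe.mp hq)).1).1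
          simp only [Finset.mem_product] at this
          simp only [Finset.coe_product, Set.mem_prod, Finset.mem_coe, Finset.mem_univ, true_and]
          split_ifs <;> simp [this]
        · rintro ⟨⟨⟨a, b⟩, w⟩, ⟨a', b'⟩, w'⟩ hq ⟨⟨⟨c, d⟩, v⟩, ⟨c', d'⟩, v'⟩ hq' he
          simp only [hQ, Finset.coe_filter, Finset.mem_filter, Set.mem_ofPred_eq,
            Prod.mk.injEq] at hq hq' he
          obtain ⟨⟨_, e1, f1⟩, rfl, rfl⟩ := hq
          obtain ⟨⟨_, e2, f2⟩, rfl, rfl⟩ := hq'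
          simp only at f1 f2
          have g1 := par_ne k (by omega) a b a' b' (by positivity) (by positivity) (by positivity)
            (by positivity) e1 (by linarith)
          have g2 := par_ne k (by omega) c d c' d' (by positivity) (by positivity) (by positivity)
            (by positivity) e2 (by linarith)
          by_cases hab : a = b <;> by_cases hcd : c = d <;>
            simp only [hab, hcd, if_true, if_false, Prod.mk.injEq, reduceCtorEq, false_and,
              true_and] at he
          · simp only [Prod.mk.injEq, and_true]
            omega
          · simp only [Prod.mk.injEq, and_true]
            omega
      rw [Finset.card_product, Finset.card_product, hIc] at this
      simp only [Finset.card_univ, Fintype.card_bool] at this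
      have h2 : (((Q.filter (fun q => (q.1.2, q.2.2) = ((y1,y2),(z1,z2)))).card : ℕ) : ℝ)
          ≤ 2 * (N:ℝ)^2 := by
        calc _ ≤ ((2 * (N * N) : ℕ) : ℝ) := Nat.cast_le.mpr this
          _ = _ := by push_cast; ring
      have : 0 ≤ (C * (N:ℝ)^(δ/2))^2 := by positivity
      linarith
    · simp only [hn, if_false, add_zero]
      set n := ((z1:ℤ)^k + (z2:ℤ)^k) - ((y1:ℤ)^k + (y2:ℤ)^k) with hn'
      have hne : n ≠ 0 := by
        intro h0
        apply hn; linarith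
      have hle : |n| ≤ 2 * (N:ℤ)^k := by
        have := hIN y1 hu.1.1
        have := hIN y2 hu.1.2
        have := hIN z1 hu.2.1
        have := hIN z2 hu.2.2
        rw [abs_le]; constructor <;> linarith
      have hd := h N hN n hne hle
      have hcard : (Q.filter (fun q => (q.1.2, q.2.2) = ((y1,y2),(z1,z2)))).card
          ≤ (n.divisors ×ˢ n.divisors).card := by
        apply Finset.card_le_card_of_injOn (fun q =>
          ((q.1.1.1:ℤ) - (q.1.1.2:ℤ), (q.1.1.1:ℤ) - (q.2.1.1:ℤ)))
        · rintro ⟨⟨⟨a, b⟩, w⟩, ⟨a', b'⟩, w'⟩ hq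
          simp only [hQ, Finset.coe_filter, Finset.mem_filter, Set.mem_ofPred_eq,
            Prod.mk.injEq] at hq
          obtain ⟨⟨_, e1, f1⟩, rfl, rfl⟩ := hq
          simp only [Finset.coe_product, Set.mem_prod, Finset.mem_coe, Int.mem_divisors]
          have := par_dvd k a b a' b' e1
          simp only at f1
          rw [show (a:ℤ)^k - (b:ℤ)^k - (a':ℤ)^k + (b':ℤ)^k = n by linarith] at this
          exact ⟨⟨this.1, hne⟩, this.2, hne⟩
        · rintro ⟨⟨⟨a, b⟩, w⟩, ⟨a', b'⟩, w'⟩ hq ⟨⟨⟨c, d⟩, v⟩, ⟨c', d'⟩, v'⟩ hq' he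
          simp only [hQ, Finset.coe_filter, Finset.mem_filter, Set.mem_ofPred_eq,
            Prod.mk.injEq] at hq hq' he
          obtain ⟨⟨_, e1, f1⟩, rfl, rfl⟩ := hq
          obtain ⟨⟨_, e2, f2⟩, rfl, rfl⟩ := hq'
          simp only at f1 f2
          have hF : (a:ℤ)^k - (b:ℤ)^k - (a':ℤ)^k + (b':ℤ)^k = n := by linarith
          have hF2 : (c:ℤ)^k - (d:ℤ)^k - (c':ℤ)^k + (d':ℤ)^k = n := by linarith
          have hab : (a:ℤ) ≠ b := by
            intro h0
            have : (a':ℤ) = b' := by linarith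
            rw [h0, this] at hF
            apply hne; linarith
          have haa : (a:ℤ) ≠ a' := by
            intro h0
            have : (b:ℤ) = b' := by linarith
            rw [h0, this] at hF
            apply hne; linarith
          have := par_inj k hk a b a' b' c d c' d' (by positivity) (by positivity) (by positivity)
            (by positivity) (by positivity) (by positivity) (by positivity) (by positivity)
            e1 e2 he.1 he.2 hab haa (by linarith)
          simp only [Prod.mk.injEq, and_true]
          omega
      rw [Finset.card_product] at hcard
      calc _ ≤ ((n.divisors.card * n.divisors.card : ℕ) : ℝ) := Nat.cast_le.mpr hcard
        _ = (n.divisors.card : ℝ)^2 := by push_cast; ring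
        _ ≤ _ := pow_le_pow_left₀ (by positivity) hd 2
  have hsq : ((N:ℝ)^(δ/2))^2 = (N:ℝ)^δ := by
    rw [← Real.rpow_natCast, ← Real.rpow_mul (by positivity)]; congr 1; push_cast; ring
  calc _ ≤ ∑ u ∈ (I ×ˢ I) ×ˢ (I ×ˢ I), ((C * (N:ℝ)^(δ/2))^2 +
        if (u.1.1:ℤ)^k + (u.1.2:ℤ)^k = (u.2.1:ℤ)^k + (u.2.2:ℤ)^k then 2 * (N:ℝ)^2 else 0) :=
        Finset.sum_le_sum hfib
    _ ≤ C^2 * (N:ℝ)^δ * (N:ℝ)^4 + (C4 * (N:ℝ)^(2+δ)) * (2 * (N:ℝ)^2) := by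
        rw [Finset.sum_add_distrib]
        apply add_le_add
        · rw [Finset.sum_const, Finset.card_product, Finset.card_product, hIc, mul_pow, hsq,
            nsmul_eq_mul]
          push_cast
          apply le_of_eq; ring
        · rw [← Finset.sum_filter, Finset.sum_const, nsmul_eq_mul]
          exact mul_le_mul_of_nonneg_right h4 (by positivity)
    _ = _ := by
        rw [Real.rpow_add (by linarith), Real.rpow_add (by linarith)]
        have e2 : (N:ℝ)^(2:ℝ) = (N:ℝ)^2 := by norm_cast
        have e4 : (N:ℝ)^(4:ℝ) = (N:ℝ)^4 := by norm_cast
        rw [e2, e4]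
        ring

lemma e_add (x y : ℝ) : e (x + y) = e x * e y := by
  unfold e; rw [← Complex.exp_add]; congr 1; push_cast; ring

lemma e_conj (x : ℝ) : (starRingEnd ℂ) (e x) = e (-x) := by
  unfold e; rw [← Complex.exp_conj]; congr 1
  simp [Complex.conj_ofReal]
  left; exact map_ofNat (starRingEnd ℂ) 2

lemma e_cont : Continuous e := by
  unfold e; fun_prop

lemma e_norm (x : ℝ) : ‖e x‖ = 1 := by
  unfold e
  rw [show 2 * (Real.pi:ℂ) * Complex.I * x = ((2 * Real.pi * x : ℝ) : ℂ) * Complex.I by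
    push_cast; ring]
  exact Complex.norm_exp_ofReal_mul_I _

lemma e_int_one (n : ℤ) : e (n:ℝ) = 1 := by
  unfold e
  rw [Complex.exp_eq_one_iff]
  exact ⟨n, by push_cast; ring⟩

lemma integral_e (n : ℤ) : ∫ α in (0:ℝ)..1, e ((n:ℝ) * α) = if n = 0 then 1 else 0 := by
  split_ifs with h
  · subst h; simp [e]
  · have hc : (2 * (Real.pi:ℂ) * Complex.I * n) ≠ 0 := by
      have : (n:ℂ) ≠ 0 := by exact_mod_cast h
      simp [Complex.I_ne_zero, this, Real.pi_ne_zero]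
    have h1 : ∀ α : ℝ, e ((n:ℝ) * α) = Complex.exp ((2 * (Real.pi:ℂ) * Complex.I * n) * α) := by
      intro α; unfold e; congr 1; push_cast; ring
    simp_rw [h1]
    rw [integral_exp_mul_complex hc]
    have h2 : Complex.exp ((2 * (Real.pi:ℂ) * Complex.I * n) * (1:ℝ)) = 1 := by
      rw [Complex.exp_eq_one_iff]
      exact ⟨n, by push_cast; ring⟩
    rw [h2]; simp

/-- trigonometric polynomial -/
noncomputable def tpoly {ι : Type*} (I : Finset ι) (c : ι → ℂ) (φ : ι → ℤ) (α : ℝ) : ℂ :=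
  ∑ i ∈ I, c i * e ((φ i : ℝ) * α)

lemma tpoly_cont {ι : Type*} (I : Finset ι) (c : ι → ℂ) (φ : ι → ℤ) :
    Continuous (tpoly I c φ) := by
  unfold tpoly
  refine continuous_finsetSum _ fun i _ => ?_
  exact continuous_const.mul (e_cont.comp (by fun_prop))

lemma tpoly_periodic {ι : Type*} (I : Finset ι) (c : ι → ℂ) (φ : ι → ℤ) :
    Function.Periodic (tpoly I c φ) 1 := by
  intro α
  unfold tpoly
  refine Finset.sum_congr rfl fun i _ => ?_
  rw [mul_add, e_add, mul_one, e_int_one, mul_one]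

lemma tpoly_mul {ι κ : Type*} (I : Finset ι) (c : ι → ℂ) (φ : ι → ℤ)
    (J : Finset κ) (d : κ → ℂ) (ψ : κ → ℤ) (α : ℝ) :
    tpoly I c φ α * tpoly J d ψ α
      = tpoly (I ×ˢ J) (fun p => c p.1 * d p.2) (fun p => φ p.1 + ψ p.2) α := by
  unfold tpoly
  rw [Finset.sum_mul_sum, Finset.sum_product]
  refine Finset.sum_congr rfl fun i _ => Finset.sum_congr rfl fun j _ => ?_
  push_cast
  rw [add_mul, e_add]; ring

lemma tpoly_conj {ι : Type*} (I : Finset ι) (c : ι → ℂ) (φ : ι → ℤ) (α : ℝ) :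
    (starRingEnd ℂ) (tpoly I c φ α) = tpoly I (fun i => (starRingEnd ℂ) (c i)) (fun i => - φ i) α := by
  unfold tpoly
  rw [map_sum]
  refine Finset.sum_congr rfl fun i _ => ?_
  rw [map_mul, e_conj]; push_cast; rw [neg_mul]

lemma tpoly_integral {ι : Type*} (I : Finset ι) (c : ι → ℂ) (φ : ι → ℤ) :
    ∫ α in (0:ℝ)..1, tpoly I c φ α = ∑ i ∈ I, if φ i = 0 then c i else 0 := by
  unfold tpoly
  rw [intervalIntegral.integral_finsetSum]
  · refine Finset.sum_congr rfl fun i _ => ?_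
    rw [intervalIntegral.integral_const_mul, integral_e]
    split_ifs <;> simp
  · intro i _
    exact (continuous_const.mul (e_cont.comp (by fun_prop))).intervalIntegrable _ _

lemma tpoly_parseval {ι : Type*} (I : Finset ι) (c : ι → ℂ) (φ : ι → ℤ) :
    ((∫ α in (0:ℝ)..1, ‖tpoly I c φ α‖^2 : ℝ) : ℂ)
      = ∑ q ∈ (I ×ˢ I).filter (fun q => φ q.1 = φ q.2), c q.1 * (starRingEnd ℂ) (c q.2) := by
  rw [← intervalIntegral.integral_ofReal]
  have : ∀ α : ℝ, ((‖tpoly I c φ α‖^2 : ℝ) : ℂ)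
      = tpoly (I ×ˢ I) (fun p => c p.1 * (starRingEnd ℂ) (c p.2)) (fun p => φ p.1 + - φ p.2) α := by
    intro α
    rw [← tpoly_mul I c φ I (fun i => (starRingEnd ℂ) (c i)) (fun i => - φ i), ← tpoly_conj,
      Complex.mul_conj']
    push_cast; rfl
  simp_rw [this]
  rw [tpoly_integral, Finset.sum_filter]
  refine Finset.sum_congr rfl fun q _ => ?_
  simp only [add_neg_eq_zero]

lemma tpoly_count {ι : Type*} (I : Finset ι) (φ : ι → ℤ) :
    ∫ α in (0:ℝ)..1, ‖tpoly I (fun _ => 1) φ α‖^2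
      = ((I ×ˢ I).filter (fun q => φ q.1 = φ q.2)).card := by
  have := tpoly_parseval I (fun _ => 1) φ
  simp only [map_one, mul_one, Finset.sum_const, nsmul_eq_mul] at this
  exact_mod_cast this

lemma tpoly_major {ι : Type*} (I J : Finset ι) (hIJ : I ⊆ J) (c : ι → ℂ) (φ : ι → ℤ) (W : ℝ)
    (hW : ∀ i ∈ I, ‖c i‖ ≤ W) :
    ∫ α in (0:ℝ)..1, ‖tpoly I c φ α‖^2 ≤ W^2 *
      ((J ×ˢ J).filter (fun q => φ q.1 = φ q.2)).card := by
  have h := tpoly_parseval I c φ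
  have h0 : 0 ≤ ∫ α in (0:ℝ)..1, ‖tpoly I c φ α‖^2 :=
    intervalIntegral.integral_nonneg (by norm_num) (fun _ _ => by positivity)
  have h1 : ∫ α in (0:ℝ)..1, ‖tpoly I c φ α‖^2
      = ‖((∫ α in (0:ℝ)..1, ‖tpoly I c φ α‖^2 : ℝ) : ℂ)‖ := by
    rw [Complex.norm_real, Real.norm_of_nonneg h0]
  rw [h1, h]
  calc _ ≤ ∑ q ∈ (I ×ˢ I).filter (fun q => φ q.1 = φ q.2), W^2 := by
        apply norm_sum_le_of_le
        intro q hq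
        simp only [Finset.mem_filter, Finset.mem_product] at hq
        rw [norm_mul, RCLike.norm_conj, sq]
        exact mul_le_mul (hW _ hq.1.1) (hW _ hq.1.2) (norm_nonneg _)
          ((norm_nonneg _).trans (hW _ hq.1.1))
    _ = W^2 * ((I ×ˢ I).filter (fun q => φ q.1 = φ q.2)).card := by
        rw [Finset.sum_const, nsmul_eq_mul, mul_comm]
    _ ≤ _ := by
        apply mul_le_mul_of_nonneg_left _ (by positivity)
        exact Nat.cast_le.mpr (Finset.card_le_card
          (Finset.filter_subset_filter _ (Finset.product_subset_product hIJ hIJ)))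

lemma mean4 (k : ℕ) (hk : 2 ≤ k) (δ : ℝ) (hδ : 0 < δ) : ∃ C : ℝ, 1 ≤ C ∧ ∀ N : ℕ, 1 ≤ N →
    ∀ (S : Finset ℕ) (c : ℕ → ℂ) (W : ℝ), S ⊆ Icc 1 N → (∀ m ∈ S, ‖c m‖ ≤ W) → 
    ∫ α in (0:ℝ)..1, ‖tpoly S c (fun m => (m:ℤ)^k) α‖^4 ≤ C * W^4 * (N:ℝ)^(2+δ) := by
  obtain ⟨C, hC, h⟩ := count4 k hk δ hδ
  refine ⟨C, hC, fun N hN S c W hS hW => ?_⟩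
  have h1 : ∀ α, ‖tpoly S c (fun m => (m:ℤ)^k) α‖^4 = ‖tpoly (S ×ˢ S) (fun p => c p.1 * c p.2)
      (fun p => (p.1:ℤ)^k + (p.2:ℤ)^k) α‖^2 := by
    intro α
    rw [← tpoly_mul S c (fun m => (m:ℤ)^k) S c (fun m => (m:ℤ)^k), norm_mul]; ring
  simp_rw [h1]
  refine (tpoly_major (S ×ˢ S) (Icc 1 N ×ˢ Icc 1 N) (Finset.product_subset_product hS hS) _ _ (W^2) 
    ?_).trans ?_
  · intro p hp
    simp only [Finset.mem_product] at hp
    rw [norm_mul, sq]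
    exact mul_le_mul (hW _ hp.1) (hW _ hp.2) (norm_nonneg _) ((norm_nonneg _).trans (hW _ hp.1))
  · calc _ ≤ (W^2)^2 * (C * (N:ℝ)^(2+δ)) := by
          apply mul_le_mul_of_nonneg_left _ (by positivity)
          exact h N hN
      _ = _ := by ring

lemma hua8 (k : ℕ) (hk : 3 ≤ k) (δ : ℝ) (hδ : 0 < δ) : ∃ C : ℝ, 1 ≤ C ∧ ∀ N : ℕ, 1 ≤ N →
    ∫ α in (0:ℝ)..1, ‖tpoly (Icc 1 N) (fun _ => 1) (fun m => (m:ℤ)^k) α‖^8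
      ≤ C * (N:ℝ)^(5+δ) := by
  obtain ⟨C, hC, h⟩ := count8 k hk δ hδ
  refine ⟨3 * C, by linarith, fun N hN => ?_⟩
  have hN1 : (1:ℝ) ≤ N := by exact_mod_cast hN
  replace h := h N hN
  set I := Icc 1 N with hI
  set J := (I ×ˢ I) ×ˢ (I ×ˢ I) with hJ
  set f := tpoly I (fun _ => 1) (fun m => (m:ℤ)^k) with hf
  set φ : (ℕ × ℕ) × (ℕ × ℕ) → ℤ :=
    fun i => ((i.1.1:ℤ)^k - (i.1.2:ℤ)^k) + ((i.2.1:ℤ)^k + (i.2.2:ℤ)^k) with hφ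
  set hd : (ℕ × ℕ) × (ℕ × ℕ) → ℤ := fun i => (i.1.1:ℤ) - (i.1.2:ℤ) with hhd
  set H := Finset.Icc (-(N:ℤ)) N with hH
  have hmap : ∀ i ∈ J, hd i ∈ H := by
    intro i hi
    simp only [hJ, hI, Finset.mem_product, Finset.mem_Icc] at hi
    simp only [hH, hhd, Finset.mem_Icc]
    omega
  have hHc : (H.card : ℝ) ≤ 3 * N := by
    have : H.card = 2 * N + 1 := by
      rw [hH, Int.card_Icc]; omega
    rw [this]; push_cast; linarith
  have hpt : ∀ α, ‖f α‖^8 ≤ 3 * N * ∑ j ∈ H, ‖tpoly (J.filter (fun i => hd i = j)) (fun _ => 1) φ α‖^2 := by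
    intro α
    have h4 : ‖f α‖^4 = ‖∑ j ∈ H, tpoly (J.filter (fun i => hd i = j)) (fun _ => 1) φ α‖ := by
      have e1 : ∑ j ∈ H, tpoly (J.filter (fun i => hd i = j)) (fun _ => 1) φ α
          = tpoly J (fun _ => 1) φ α := by
        unfold tpoly
        exact Finset.sum_fiberwise_of_maps_to hmap _
      have e2 : tpoly J (fun _ => 1) φ α = (f α * (starRingEnd ℂ) (f α)) * (f α * f α) := by
        rw [hf, tpoly_conj, tpoly_mul, tpoly_mul, tpoly_mul]
        simp only [map_one, mul_one]
        rfl
      rw [e1, e2, norm_mul, norm_mul, norm_mul, RCLike.norm_conj]; ring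
    calc ‖f α‖^8 = (‖f α‖^4)^2 := by ring
      _ ≤ (∑ j ∈ H, ‖tpoly (J.filter (fun i => hd i = j)) (fun _ => 1) φ α‖)^2 := by
          rw [h4]; exact pow_le_pow_left₀ (norm_nonneg _) (norm_sum_le _ _) 2
      _ ≤ H.card * ∑ j ∈ H, ‖tpoly (J.filter (fun i => hd i = j)) (fun _ => 1) φ α‖^2 :=
          sq_sum_le_card_mul_sum_sq
      _ ≤ _ := mul_le_mul_of_nonneg_right hHc (Finset.sum_nonneg (fun _ _ => by positivity))
  have hfc : Continuous f := tpoly_cont _ _ _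
  have hgc : ∀ j, Continuous (fun α => ‖tpoly (J.filter (fun i => hd i = j)) (fun _ => 1) φ α‖^2) :=
    fun j => ((tpoly_cont _ _ _).norm).pow 2
  calc ∫ α in (0:ℝ)..1, ‖f α‖^8
      ≤ ∫ α in (0:ℝ)..1, 3 * N * ∑ j ∈ H, ‖tpoly (J.filter (fun i => hd i = j)) (fun _ => 1) φ α‖^2 := by
        apply intervalIntegral.integral_mono_on (by norm_num)
        · exact (hfc.norm.pow 8).intervalIntegrable _ _
        · exact (continuous_const.mul (continuous_finsetSum _ fun j _ => hgc j)).intervalIntegrable _ _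
        · exact fun α _ => hpt α
    _ = 3 * N * ∑ j ∈ H, ((((J.filter (fun i => hd i = j)) ×ˢ (J.filter (fun i => hd i = j))).filter
          (fun q => φ q.1 = φ q.2)).card : ℝ) := by
        rw [intervalIntegral.integral_const_mul, intervalIntegral.integral_finsetSum]
        · simp_rw [tpoly_count]
        · intro j _; exact (hgc j).intervalIntegrable _ _
    _ ≤ 3 * N * (C * (N:ℝ)^(4+δ)) := by
        apply mul_le_mul_of_nonneg_left _ (by positivity)
        refine le_trans ?_ h
        rw [← Nat.cast_sum]
        apply Nat.cast_le.mpr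
        rw [Finset.card_eq_sum_card_fiberwise (f := fun q => hd q.1) (t := H)]
        · apply Finset.sum_le_sum
          intro j _
          apply Finset.card_le_card
          intro q hq
          simp only [Finset.mem_filter, Finset.mem_product] at hq ⊢
          obtain ⟨⟨⟨a1, a2⟩, a3, a4⟩, a5⟩ := hq
          refine ⟨⟨⟨?_, ?_⟩, ?_, a5⟩, a2⟩
          · simpa [hJ] using a1
          · simpa [hJ] using a3
          · exact a2.trans a4.symm
        · intro q hq
          have := (Finset.mem_filter.mp (Finset.mem_coe.mp hq)).1
          exact hmap _ (Finset.mem_product.mp this).1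
    _ = _ := by
        rw [show (5 + δ) = 1 + (4 + δ) by ring, Real.rpow_add (by linarith) 1, Real.rpow_one]
        ring

lemma mean8 (k : ℕ) (hk : 3 ≤ k) (δ : ℝ) (hδ : 0 < δ) : ∃ C : ℝ, 1 ≤ C ∧ ∀ N : ℕ, 1 ≤ N →
    ∀ (S : Finset ℕ) (c : ℕ → ℂ) (W : ℝ), S ⊆ Icc 1 N → (∀ m ∈ S, ‖c m‖ ≤ W) → 
    ∫ α in (0:ℝ)..1, ‖tpoly S c (fun m => (m:ℤ)^k) α‖^8 ≤ C * W^8 * (N:ℝ)^(5+δ) := by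
  obtain ⟨C, hC, h⟩ := hua8 k hk δ hδ
  refine ⟨C, hC, fun N hN S c W hS hW => ?_⟩
  have h1 : ∀ (T : Finset ℕ) (d : ℕ → ℂ) α, ‖tpoly T d (fun m => (m:ℤ)^k) α‖^8
      = ‖tpoly ((T ×ˢ T) ×ˢ (T ×ˢ T)) (fun p => (d p.1.1 * d p.1.2) * (d p.2.1 * d p.2.2))
      (fun p => ((p.1.1:ℤ)^k + (p.1.2:ℤ)^k) + ((p.2.1:ℤ)^k + (p.2.2:ℤ)^k)) α‖^2 := by
    intro T d α
    rw [← tpoly_mul (T ×ˢ T) (fun p => d p.1 * d p.2) (fun p => (p.1:ℤ)^k + (p.2:ℤ)^k)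
      (T ×ˢ T) (fun p => d p.1 * d p.2) (fun p => (p.1:ℤ)^k + (p.2:ℤ)^k),
      ← tpoly_mul T d (fun m => (m:ℤ)^k) T d (fun m => (m:ℤ)^k), norm_mul, norm_mul]; ring
  have h2 := h N hN
  simp_rw [h1] at h2 ⊢
  simp only [mul_one] at h2
  rw [tpoly_count] at h2
  refine (tpoly_major ((S ×ˢ S) ×ˢ (S ×ˢ S)) ((Icc 1 N ×ˢ Icc 1 N) ×ˢ (Icc 1 N ×ˢ Icc 1 N))
    (Finset.product_subset_product (Finset.product_subset_product hS hS)
      (Finset.product_subset_product hS hS)) _ _ (W^4) ?_).trans ?_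
  · intro p hp
    simp only [Finset.mem_product] at hp
    have hW0 : 0 ≤ W := (norm_nonneg _).trans (hW _ hp.1.1)
    rw [norm_mul, norm_mul, norm_mul, show W^4 = (W*W)*(W*W) by ring]
    have a := hW _ hp.1.1
    have b := hW _ hp.1.2
    have c' := hW _ hp.2.1
    have d' := hW _ hp.2.2
    gcongr
  · calc _ ≤ (W^4)^2 * (C * (N:ℝ)^(5+δ)) := by
          apply mul_le_mul_of_nonneg_left h2 (by positivity)
      _ = _ := by ring

lemma tail_one (g : ℝ → ℝ) (hc : Continuous g) (h0 : ∀ x, 0 ≤ g x) (T : ℝ) (hT : 0 < T)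
    (hp : Function.Periodic g T) (R : ℝ) (hR : 1 ≤ R) :
    ∫⁻ α in Set.Ici R, ENNReal.ofReal (g α / α^2)
      ≤ ENNReal.ofReal ((1+T)/T / R * ∫ α in (0:ℝ)..T, g α) := by
  set M := ∫ α in (0:ℝ)..T, g α with hM
  have hM0 : 0 ≤ M := intervalIntegral.integral_nonneg hT.le (fun x _ => h0 x)
  set s : ℕ → Set ℝ := fun n => Set.Icc (R + n * T) (R + n * T + T) with hs
  have hsub : Set.Ici R ⊆ ⋃ n, s n := by
    intro x hx
    have hx' : R ≤ x := hx
    simp only [Set.mem_iUnion, hs, Set.mem_Icc]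
    have hq : 0 ≤ (x - R)/T := div_nonneg (by linarith) hT.le
    refine ⟨⌊(x - R)/T⌋₊, ?_, ?_⟩
    · have := Nat.floor_le hq
      rw [le_div_iff₀ hT] at this; linarith
    · have := (Nat.lt_floor_add_one ((x-R)/T)).le
      rw [div_le_iff₀ hT] at this; linarith
  set u : ℕ → ℝ := fun n => 1 / (R + n * T) with hu
  have hpos : ∀ n : ℕ, 1 ≤ R + n * T := by
    intro n
    have : 0 ≤ (n:ℝ) * T := by positivity
    linarith
  have hu0 : ∀ n, 0 ≤ u n := fun n => by
    have := hpos n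
    simp only [hu]; positivity
  have hdiff : ∀ n : ℕ, 1 / (R + n * T)^2 ≤ (1+T)/T * (u n - u (n+1)) := by
    intro n
    have hy := hpos n
    set y := R + n * T with hy'
    have : u n - u (n+1) = T / (y * (y + T)) := by
      have e1 : u (n+1) = 1 / (y + T) := by
        simp only [hu, hy']; congr 1; push_cast; ring
      have e2 : u n = 1 / y := rfl
      have : y ≠ 0 := by linarith
      have : y + T ≠ 0 := by linarith
      rw [e1, e2]; field_simp; ring
    rw [this, div_mul_div_comm, div_le_div_iff₀ (by positivity) (by positivity)]
    have : 0 ≤ T * y * (T * (y - 1)) := by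
      have : 0 ≤ y - 1 := by linarith
      positivity
    nlinarith
  have hblock : ∀ n, ∫⁻ α in s n, ENNReal.ofReal (g α / α^2)
      ≤ ENNReal.ofReal (M * ((1+T)/T * (u n - u (n+1)))) := by
    intro n
    have hy := hpos n
    calc ∫⁻ α in s n, ENNReal.ofReal (g α / α^2)
        ≤ ∫⁻ α in s n, ENNReal.ofReal (g α * (1 / (R + n * T)^2)) := by
          apply setLIntegral_mono' measurableSet_Icc
          intro x hx
          apply ENNReal.ofReal_le_ofReal
          rw [mul_one_div]
          apply div_le_div_of_nonneg_left (h0 x) (by positivity)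
          exact pow_le_pow_left₀ (by linarith) hx.1 2
      _ = ENNReal.ofReal (∫ α in s n, g α * (1 / (R + n * T)^2)) := by
          rw [ofReal_integral_eq_lintegral_ofReal]
          · exact (hc.mul continuous_const).continuousOn.integrableOn_Icc
          · exact Filter.Eventually.of_forall (fun x => mul_nonneg (h0 x) (by positivity))
      _ ≤ _ := by
          apply ENNReal.ofReal_le_ofReal
          rw [integral_mul_const, integral_Icc_eq_integral_Ioc,
            ← intervalIntegral.integral_of_le (by linarith),
            hp.intervalIntegral_add_eq (R + n * T) 0, zero_add]
          exact mul_le_mul_of_nonneg_left (hdiff n) hM0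
  calc _ ≤ ∫⁻ α in ⋃ n, s n, ENNReal.ofReal (g α / α^2) := lintegral_mono_set hsub
    _ ≤ ∑' n, ∫⁻ α in s n, ENNReal.ofReal (g α / α^2) := lintegral_iUnion_le _ _
    _ ≤ ∑' n, ENNReal.ofReal (M * ((1+T)/T * (u n - u (n+1)))) := ENNReal.tsum_le_tsum hblock
    _ ≤ _ := by
        apply ENNReal.tsum_le_of_sum_range_le
        intro n
        rw [← ENNReal.ofReal_sum_of_nonneg]
        · apply ENNReal.ofReal_le_ofReal
          rw [← Finset.mul_sum, ← Finset.mul_sum, Finset.sum_range_sub']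
          have e0 : u 0 = 1 / R := by simp [hu]
          rw [e0]
          have h2 := hu0 n
          calc M * ((1+T)/T * (1/R - u n)) ≤ M * ((1+T)/T * (1/R)) := by
                gcongr; linarith
            _ = _ := by ring
        · intro i _
          refine mul_nonneg hM0 (le_trans ?_ (hdiff i))
          positivity

lemma tail (g : ℝ → ℝ) (hc : Continuous g) (h0 : ∀ x, 0 ≤ g x)
    (hp : Function.Periodic g 1) (l : ℝ) (hl : 0 < l) (R : ℝ) (hR : 1 ≤ R) :
    IntegrableOn (fun α => g (l * α) / α^2) {α : ℝ | R ≤ |α|} ∧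
    ∫ α in {α : ℝ | R ≤ |α|}, g (l * α) / α^2 ≤ 2 * (1 + 1/l) / R * ∫ α in (0:ℝ)..1, g α := by
  set M := ∫ α in (0:ℝ)..1, g α with hM
  have hM0 : 0 ≤ M := intervalIntegral.integral_nonneg (by norm_num) (fun x _ => h0 x)
  have hc1 : Continuous (fun α => g (l * α)) := hc.comp (by fun_prop)
  have hp1 : Function.Periodic (fun α => g (l * α)) (1/l) := by
    intro x
    have : l * (x + 1/l) = l * x + 1 := by field_simp
    simp only [this]; exact hp _
  have hint : ∫ α in (0:ℝ)..(1/l), g (l * α) = 1/l * M := by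
    rw [intervalIntegral.integral_comp_mul_left _ hl.ne']
    simp [hM, hl.ne']
  have hint2 : ∫ α in (0:ℝ)..(1/l), g (l * (-α)) = 1/l * M := by
    have := intervalIntegral.integral_comp_neg (a := 0) (b := 1/l) (fun α => g (l * α))
    rw [this]
    have h3 := hp1.intervalIntegral_add_eq (-(1/l)) 0
    rw [neg_add_cancel, zero_add] at h3
    rw [neg_zero, h3, hint]
  have hc2 : Continuous (fun α => g (l * (-α))) := hc.comp (by fun_prop)
  have hp2 : Function.Periodic (fun α => g (l * (-α))) (1/l) := by
    intro x
    have : l * (-(x + 1/l)) = l * (-x) - 1 := by field_simp; ring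
    simp only [this]; exact hp.sub_eq _
  have hset : {α : ℝ | R ≤ |α|} = Set.Ici R ∪ Set.Iic (-R) := by
    ext x; simp only [Set.mem_ofPred_eq, Set.mem_union, Set.mem_Ici, Set.mem_Iic, le_abs]
    constructor
    · rintro (h | h)
      · left; exact h
      · right; linarith
    · rintro (h | h)
      · left; exact h
      · right; linarith
  have hcoef : (1 + 1/l)/(1/l) / R * (1/l * M) = (1 + 1/l)/R * M := by
    field_simp
  have t1 := tail_one _ hc1 (fun x => h0 _) (1/l) (by positivity) hp1 R hR
  have t2 := tail_one _ hc2 (fun x => h0 _) (1/l) (by positivity) hp2 R hR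
  rw [hint, hcoef] at t1
  rw [hint2, hcoef] at t2
  have t3 : ∫⁻ α in Set.Iic (-R), ENNReal.ofReal (g (l * α) / α^2)
      = ∫⁻ α in Set.Ici R, ENNReal.ofReal (g (l * (-α)) / α^2) := by
    have := (Measure.measurePreserving_neg (volume : Measure ℝ)).setLIntegral_comp_preimage
      (s := Set.Iic (-R)) measurableSet_Iic
      (f := fun α => ENNReal.ofReal (g (l * α) / α^2)) (by
        have : Measurable (fun α => g (l * α)) := hc1.measurable
        fun_prop)
    rw [← this]
    have hpre : (Neg.neg ⁻¹' Set.Iic (-R) : Set ℝ) = Set.Ici R := by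
      ext x; simp
    rw [hpre]
    simp
  have htot : ∫⁻ α in {α : ℝ | R ≤ |α|}, ENNReal.ofReal (g (l * α) / α^2)
      ≤ ENNReal.ofReal (2 * (1 + 1/l) / R * M) := by
    rw [hset]
    refine (lintegral_union_le _ _ _).trans ?_
    rw [t3]
    refine (add_le_add t1 t2).trans ?_
    rw [← ENNReal.ofReal_add (by positivity) (by positivity)]
    apply ENNReal.ofReal_le_ofReal
    apply le_of_eq; ring
  have hnn : ∀ α, 0 ≤ g (l * α) / α^2 := fun α => div_nonneg (h0 _) (by positivity)
  have hmeas : Measurable (fun α => g (l * α) / α^2) := by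
    have : Measurable (fun α => g (l * α)) := hc1.measurable
    fun_prop
  constructor
  · refine ⟨hmeas.aestronglyMeasurable, ?_⟩
    rw [hasFiniteIntegral_iff_ofReal (Filter.Eventually.of_forall hnn)]
    exact htot.trans_lt ENNReal.ofReal_lt_top
  · rw [integral_eq_lintegral_of_nonneg_ae (Filter.Eventually.of_forall hnn)
      hmeas.aestronglyMeasurable]
    exact ENNReal.toReal_le_of_le_ofReal (by positivity) htot

lemma amgm (a b c d f g h : ℝ) :
    a * b * c * d * f * g * h ≤ a^4 + b^8 + c^8 + d^8 + f^8 + g^8 + h^8 := by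
  have h4 : ∀ p q r s : ℝ, p * q * r * s ≤ (p^4 + q^4 + r^4 + s^4)/4 := by
    intro p q r s
    nlinarith [sq_nonneg (p*q - r*s), sq_nonneg (p^2 - q^2), sq_nonneg (r^2 - s^2)]
  have h2 : ∀ p q : ℝ, (p * q)^4 ≤ (p^8 + q^8)/2 := by
    intro p q
    nlinarith [sq_nonneg (p^4 - q^4)]
  have := h4 a (b*c) (d*f) (g*h)
  have := h2 b c
  have := h2 d f
  have := h2 g h
  have e1 : a * b * c * d * f * g * h = a * (b*c) * (d*f) * (g*h) := by ring
  rw [e1]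
  have : 0 ≤ a^4 := by positivity
  have : 0 ≤ b^8 := by positivity
  have : 0 ≤ c^8 := by positivity
  have : 0 ≤ d^8 := by positivity
  have : 0 ≤ f^8 := by positivity
  have : 0 ≤ g^8 := by positivity
  have : 0 ≤ h^8 := by positivity
  linarith

lemma Kf_nonneg (τ α : ℝ) : 0 ≤ Kf τ α := by
  unfold Kf; split_ifs <;> positivity

lemma Kf_le (τ α : ℝ) (h : α ≠ 0) : Kf τ α ≤ 1 / α^2 := by
  unfold Kf
  rw [if_neg h, div_pow]
  have h1 : Real.sin (Real.pi * τ * α) ^ 2 ≤ 1 := Real.sin_sq_le_one _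
  have h2 : α^2 ≤ (Real.pi * α)^2 := by
    rw [mul_pow]
    have : 1 ≤ Real.pi^2 := by nlinarith [Real.pi_gt_three]
    nlinarith [sq_nonneg α]
  have h3 : 0 < α^2 := by positivity
  exact div_le_div₀ (by norm_num) h1 h3 h2

lemma SS_eq (η X : ℝ) (k : ℕ) : SS η X k = tpoly ((Finset.Icc 1 ⌊X ^ ((1:ℝ)/(k:ℝ))⌋₊).filter
      (fun p : ℕ => p.Prime ∧ (η * X) ^ ((1:ℝ)/(k:ℝ)) ≤ (p : ℝ)))
      (fun p => (Real.log p : ℂ)) (fun m => (m:ℤ)^k) := by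
  funext α
  unfold SS tpoly
  simp

lemma S2_eq (η X : ℝ) : S2 η X = tpoly ((Finset.Icc 1 ⌊X ^ ((1:ℝ)/2)⌋₊).filter
      (fun m : ℕ => (η * X) ^ ((1:ℝ)/2) ≤ (m : ℝ)))
      (fun m => (rho X m : ℂ)) (fun m => (m:ℤ)^2) := by
  funext α
  unfold S2 tpoly
  simp

lemma psi_abs (m : ℕ) (z : ℝ) : |psi m z| ≤ 1 := by
  unfold psi; split_ifs <;> simp

lemma rho_abs (X : ℝ) (m : ℕ) : |rho X m| ≤ 1 + m.divisors.card := by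
  unfold rho
  refine (abs_sub _ _).trans (add_le_add (psi_abs _ _) ?_)
  refine (Finset.abs_sum_le_sum_abs _ _).trans ?_
  refine (Finset.sum_le_sum (fun p _ => psi_abs _ _)).trans ?_
  rw [Finset.sum_const, nsmul_eq_mul, mul_one]
  apply Nat.cast_le.mpr
  apply Finset.card_le_card
  intro p hp
  have := (Finset.mem_filter.mp hp).1
  exact Nat.mem_divisors.mpr ⟨Nat.dvd_of_mem_primeFactors this,
    (Nat.mem_primeFactors.mp this).2.2⟩

lemma SS_tail (k : ℕ) (hk : 3 ≤ k) (δ : ℝ) (hδ : 0 < δ) (η : ℝ) (l : ℝ) (hl : 0 < l) :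
    ∃ C : ℝ, 0 < C ∧ ∀ X : ℝ, 1 ≤ X → ∀ R : ℝ, 1 ≤ R →
    IntegrableOn (fun α => (‖SS η X k (l * α)‖ / X ^ (5/(8*(k:ℝ)) + δ))^8 / α^2) {α : ℝ | R ≤ |α|} ∧
    ∫ α in {α : ℝ | R ≤ |α|}, (‖SS η X k (l * α)‖ / X ^ (5/(8*(k:ℝ)) + δ))^8 / α^2 ≤ C / R := by
  obtain ⟨C, hC, h⟩ := mean8 k hk (4*δ) (by positivity)
  refine ⟨2 * (1 + 1/l) * (C * (1/(δ/2))^8), by positivity, fun X hX R hR => ?_⟩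
  have hX0 : 0 < X := by linarith
  have hk1 : (1:ℝ) ≤ k := by exact_mod_cast (by omega : 1 ≤ k)
  have hc : Continuous (fun x => (‖SS η X k x‖ / X ^ (5/(8*(k:ℝ)) + δ))^8) := by
    rw [SS_eq]
    exact ((tpoly_cont _ _ _).norm.div_const _).pow 8
  have hp : Function.Periodic (fun x => (‖SS η X k x‖ / X ^ (5/(8*(k:ℝ)) + δ))^8) 1 := by
    intro x
    simp only [SS_eq]
    rw [tpoly_periodic]
  have ht := tail _ hc (fun x => by positivity) hp l hl R hR
  refine ⟨ht.1, ht.2.trans ?_⟩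
  have hN1 : 1 ≤ ⌊X ^ ((1:ℝ)/(k:ℝ))⌋₊ := by
    apply Nat.le_floor
    simpa using Real.one_le_rpow hX (by positivity)
  have hNX : ((⌊X ^ ((1:ℝ)/(k:ℝ))⌋₊ : ℕ) : ℝ) ≤ X ^ ((1:ℝ)/(k:ℝ)) :=
    Nat.floor_le (by positivity)
  have hXk : X ^ ((1:ℝ)/(k:ℝ)) ≤ X := by
    calc _ ≤ X ^ (1:ℝ) := Real.rpow_le_rpow_of_exponent_le hX (by
            rw [div_le_one (by linarith)]; exact hk1)
      _ = X := Real.rpow_one X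
  have hm := h ⌊X ^ ((1:ℝ)/(k:ℝ))⌋₊ hN1 ((Finset.Icc 1 ⌊X ^ ((1:ℝ)/(k:ℝ))⌋₊).filter
      (fun p : ℕ => p.Prime ∧ (η * X) ^ ((1:ℝ)/(k:ℝ)) ≤ (p : ℝ)))
      (fun p => (Real.log p : ℂ)) (X ^ (δ/2) / (δ/2)) (Finset.filter_subset _ _) (by
        intro m hm
        have hm' := Finset.mem_Icc.mp (Finset.mem_filter.mp hm).1
        have hm1 : (1:ℝ) ≤ m := by exact_mod_cast hm'.1
        have hmX : (m:ℝ) ≤ X := by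
          have : (m:ℝ) ≤ ((⌊X ^ ((1:ℝ)/(k:ℝ))⌋₊ : ℕ) : ℝ) := by exact_mod_cast hm'.2
          linarith
        rw [Complex.norm_real, Real.norm_of_nonneg (Real.log_nonneg hm1)]
        refine (Real.log_le_rpow_div (by linarith) (by positivity : 0 < δ/2)).trans ?_
        gcongr)
  rw [← SS_eq] at hm
  have hN5 : ((⌊X ^ ((1:ℝ)/(k:ℝ))⌋₊ : ℕ) : ℝ) ^ (5 + 4*δ) ≤ X ^ (5/(k:ℝ) + 4*δ) := by
    calc _ ≤ (X ^ ((1:ℝ)/(k:ℝ))) ^ (5 + 4*δ) :=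
          Real.rpow_le_rpow (by positivity) hNX (by positivity)
      _ = X ^ ((1:ℝ)/(k:ℝ) * (5 + 4*δ)) := by rw [← Real.rpow_mul hX0.le]
      _ ≤ _ := by
          apply Real.rpow_le_rpow_of_exponent_le hX
          have : 4 * δ / k ≤ 4 * δ := div_le_self (by positivity) hk1
          calc _ = 5/(k:ℝ) + 4*δ/k := by ring
            _ ≤ _ := by linarith
  have hW8 : (X ^ (δ/2) / (δ/2))^8 = (1/(δ/2))^8 * X ^ (4*δ) := by
    rw [div_eq_mul_one_div, mul_pow, mul_comm, ← Real.rpow_natCast (X ^ (δ/2)),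
      ← Real.rpow_mul hX0.le]
    congr 2; push_cast; ring
  have hB8 : (X ^ (5/(8*(k:ℝ)) + δ))^8 = X ^ (4*δ) * X ^ (5/(k:ℝ) + 4*δ) := by
    rw [← Real.rpow_natCast, ← Real.rpow_mul hX0.le, ← Real.rpow_add hX0]
    congr 1; push_cast; field_simp; ring
  have hI : ∫ x in (0:ℝ)..1, (‖SS η X k x‖ / X ^ (5/(8*(k:ℝ)) + δ))^8 ≤ C * (1/(δ/2))^8 := by
    simp_rw [div_pow]
    rw [intervalIntegral.integral_div, hB8, div_le_iff₀ (by positivity)]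
    refine hm.trans ?_
    rw [hW8]
    calc _ ≤ C * ((1/(δ/2))^8 * X ^ (4*δ)) * X ^ (5/(k:ℝ) + 4*δ) := by gcongr
      _ = _ := by simp only [div_pow]; ring
  calc _ ≤ 2 * (1 + 1/l) / R * (C * (1/(δ/2))^8) :=
        mul_le_mul_of_nonneg_left hI (by positivity)
    _ = _ := by ring

lemma S2_tail (δ : ℝ) (hδ : 0 < δ) (η : ℝ) (l : ℝ) (hl : 0 < l) :
    ∃ C : ℝ, 0 < C ∧ ∀ X : ℝ, 1 ≤ X → ∀ R : ℝ, 1 ≤ R →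
    IntegrableOn (fun α => (‖S2 η X (l * α)‖ / X ^ (1/4 + δ))^4 / α^2) {α : ℝ | R ≤ |α|} ∧
    ∫ α in {α : ℝ | R ≤ |α|}, (‖S2 η X (l * α)‖ / X ^ (1/4 + δ))^4 / α^2 ≤ C / R := by
  obtain ⟨C, hC, h⟩ := mean4 2 le_rfl (2*δ) (by positivity)
  obtain ⟨D, hD, hdiv⟩ := div_bound (δ/2) (by positivity)
  refine ⟨2 * (1 + 1/l) * (C * (1 + D)^4), by positivity, fun X hX R hR => ?_⟩
  have hX0 : 0 < X := by linarith
  have hc : Continuous (fun x => (‖S2 η X x‖ / X ^ (1/4 + δ))^4) := by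
    rw [S2_eq]
    exact ((tpoly_cont _ _ _).norm.div_const _).pow 4
  have hp : Function.Periodic (fun x => (‖S2 η X x‖ / X ^ (1/4 + δ))^4) 1 := by
    intro x
    simp only [S2_eq]
    rw [tpoly_periodic]
  have ht := tail _ hc (fun x => by positivity) hp l hl R hR
  refine ⟨ht.1, ht.2.trans ?_⟩
  have hN1 : 1 ≤ ⌊X ^ ((1:ℝ)/2)⌋₊ := by
    apply Nat.le_floor
    simpa using Real.one_le_rpow hX (by norm_num : (0:ℝ) ≤ 1/2)
  have hNX : ((⌊X ^ ((1:ℝ)/2)⌋₊ : ℕ) : ℝ) ≤ X ^ ((1:ℝ)/2) :=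
    Nat.floor_le (by positivity)
  have hXk : X ^ ((1:ℝ)/2) ≤ X := by
    calc _ ≤ X ^ (1:ℝ) := Real.rpow_le_rpow_of_exponent_le hX (by norm_num)
      _ = X := Real.rpow_one X
  have hm := h ⌊X ^ ((1:ℝ)/2)⌋₊ hN1 ((Finset.Icc 1 ⌊X ^ ((1:ℝ)/2)⌋₊).filter
      (fun m : ℕ => (η * X) ^ ((1:ℝ)/2) ≤ (m : ℝ)))
      (fun m => (rho X m : ℂ)) ((1 + D) * X ^ (δ/2)) (Finset.filter_subset _ _) (by
        intro m hm
        have hm' := Finset.mem_Icc.mp (Finset.mem_filter.mp hm).1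
        have hmX : (m:ℝ) ≤ X := by
          have : (m:ℝ) ≤ ((⌊X ^ ((1:ℝ)/2)⌋₊ : ℕ) : ℝ) := by exact_mod_cast hm'.2
          linarith
        rw [Complex.norm_real, Real.norm_eq_abs]
        refine (rho_abs X m).trans ?_
        have h1 := hdiv m (by omega)
        have h2 : (m:ℝ) ^ (δ/2) ≤ X ^ (δ/2) :=
          Real.rpow_le_rpow (by positivity) hmX (by positivity)
        have h3 : 1 ≤ X ^ (δ/2) := Real.one_le_rpow hX (by positivity)
        nlinarith)
  rw [← S2_eq] at hm
  have hN5 : ((⌊X ^ ((1:ℝ)/2)⌋₊ : ℕ) : ℝ) ^ (2 + 2*δ) ≤ X ^ (1 + 2*δ) := by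
    calc _ ≤ (X ^ ((1:ℝ)/2)) ^ (2 + 2*δ) :=
          Real.rpow_le_rpow (by positivity) hNX (by positivity)
      _ = X ^ ((1:ℝ)/2 * (2 + 2*δ)) := by rw [← Real.rpow_mul hX0.le]
      _ ≤ _ := by
          apply Real.rpow_le_rpow_of_exponent_le hX
          linarith
  have hW8 : ((1 + D) * X ^ (δ/2))^4 = (1 + D)^4 * X ^ (2*δ) := by
    rw [mul_pow, ← Real.rpow_natCast (X ^ (δ/2)), ← Real.rpow_mul hX0.le]
    congr 2; push_cast; ring
  have hB8 : (X ^ (1/4 + δ))^4 = X ^ (2*δ) * X ^ (1 + 2*δ) := by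
    rw [← Real.rpow_natCast, ← Real.rpow_mul hX0.le, ← Real.rpow_add hX0]
    congr 1; push_cast; ring
  have hI : ∫ x in (0:ℝ)..1, (‖S2 η X x‖ / X ^ (1/4 + δ))^4 ≤ C * (1 + D)^4 := by
    simp_rw [div_pow]
    rw [intervalIntegral.integral_div, hB8, div_le_iff₀ (by positivity)]
    refine hm.trans ?_
    rw [hW8]
    calc _ ≤ C * ((1 + D)^4 * X ^ (2*δ)) * X ^ (1 + 2*δ) := by gcongr
      _ = _ := by ring
  calc _ ≤ 2 * (1 + 1/l) / R * (C * (1 + D)^4) :=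
        mul_le_mul_of_nonneg_left hI (by positivity)
    _ = _ := by ring

/-- the trivial-arc estimate. -/
theorem trivial_arc_bound (k : ℕ) (hk : 5 ≤ k)
    (l1 l2 l3 l4 l5 l6 l7 : ℝ)
    (h1 : 0 < l1) (h2 : 0 < l2) (h3 : 0 < l3) (h4 : 0 < l4)
    (h5 : 0 < l5) (h6 : 0 < l6) (h7 : 0 < l7)
    (ε : ℝ) (hε : 0 < ε) (η : ℝ) (hη : 0 < η) (hη1 : η < 1) :
    ∃ C > (0:ℝ), ∃ X₀ : ℝ, ∀ X ≥ X₀, ∀ τ : ℝ, 0 < τ → τ < 1 →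
      (∫ α in {α : ℝ |
            (1/τ^2) * X ^ ((5*(k:ℝ) - 12)/(32*(k:ℝ))) * (Real.log X) ^ 3 ≤ |α|},
          ‖S2 η X (l1 * α) * SS η X 3 (l2 * α) * SS η X 3 (l3 * α) *
            SS η X 3 (l4 * α) * SS η X 3 (l5 * α) * SS η X 4 (l6 * α) *
            SS η X k (l7 * α)‖ * Kf τ α)
        ≤ C * ((1/τ^2) * X ^ ((5*(k:ℝ) - 12)/(32*(k:ℝ))) * (Real.log X) ^ 3)⁻¹ *
            X ^ ((13:ℝ)/12 + 5/32 + 5/(8*(k:ℝ)) + ε) := by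
  set δ := ε / 7 with hδd
  have hδ : 0 < δ := by positivity
  obtain ⟨C1, hC1, t1⟩ := S2_tail δ hδ η l1 h1
  obtain ⟨C2, hC2, t2⟩ := SS_tail 3 le_rfl δ hδ η l2 h2
  obtain ⟨C3, hC3, t3⟩ := SS_tail 3 le_rfl δ hδ η l3 h3
  obtain ⟨C4, hC4, t4⟩ := SS_tail 3 le_rfl δ hδ η l4 h4
  obtain ⟨C5, hC5, t5⟩ := SS_tail 3 le_rfl δ hδ η l5 h5
  obtain ⟨C6, hC6, t6⟩ := SS_tail 4 (by norm_num) δ hδ η l6 h6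
  obtain ⟨C7, hC7, t7⟩ := SS_tail k (by omega) δ hδ η l7 h7
  refine ⟨C1 + C2 + C3 + C4 + C5 + C6 + C7, by positivity, Real.exp 1, fun X hX τ hτ hτ1 => ?_⟩
  have hX1 : 1 ≤ X := le_trans (Real.one_le_exp (by norm_num)) hX
  have hX0 : 0 < X := by linarith
  have hlog : 1 ≤ Real.log X := by
    rw [Real.le_log_iff_exp_le hX0]; exact hX
  have hk5 : (5:ℝ) ≤ k := by exact_mod_cast hk
  set R := (1/τ^2) * X ^ ((5*(k:ℝ) - 12)/(32*(k:ℝ))) * (Real.log X) ^ 3 with hRd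
  have hR : 1 ≤ R := by
    have a1 : 1 ≤ 1/τ^2 := by
      rw [le_div_iff₀ (by positivity)]; nlinarith
    have a2 : 1 ≤ X ^ ((5*(k:ℝ) - 12)/(32*(k:ℝ))) :=
      Real.one_le_rpow hX1 (div_nonneg (by linarith) (by positivity))
    have a3 : 1 ≤ (Real.log X) ^ 3 := one_le_pow₀ hlog
    exact one_le_mul_of_one_le_of_one_le (one_le_mul_of_one_le_of_one_le a1 a2) a3
  obtain ⟨i1, u1⟩ := t1 X hX1 R hR
  obtain ⟨i2, u2⟩ := t2 X hX1 R hR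
  obtain ⟨i3, u3⟩ := t3 X hX1 R hR
  obtain ⟨i4, u4⟩ := t4 X hX1 R hR
  obtain ⟨i5, u5⟩ := t5 X hX1 R hR
  obtain ⟨i6, u6⟩ := t6 X hX1 R hR
  obtain ⟨i7, u7⟩ := t7 X hX1 R hR
  set B1 := X ^ (1/4 + δ) with hB1
  set B3 := X ^ (5/(8*((3:ℕ):ℝ)) + δ) with hB3
  set B4 := X ^ (5/(8*((4:ℕ):ℝ)) + δ) with hB4
  set Bk := X ^ (5/(8*(k:ℝ)) + δ) with hBk
  have p1 : 0 < B1 := by positivity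
  have p3 : 0 < B3 := by positivity
  have p4 : 0 < B4 := by positivity
  have pk : 0 < Bk := by positivity
  have hP : X ^ ((13:ℝ)/12 + 5/32 + 5/(8*(k:ℝ)) + ε) = B1 * B3 * B3 * B3 * B3 * B4 * Bk := by
    rw [hB1, hB3, hB4, hBk]
    simp only [← Real.rpow_add hX0]
    congr 1
    have : ε = 7 * δ := by rw [hδd]; ring
    rw [this]; push_cast; ring
  rw [hP]
  set P := B1 * B3 * B3 * B3 * B3 * B4 * Bk with hPd
  have hP0 : 0 < P := by positivity
  have j2 := i1.add i2
  have j3 := j2.add i3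
  have j4 := j3.add i4
  have j5 := j4.add i5
  have j6 := j5.add i6
  have j7 := j6.add i7
  have hms : MeasurableSet {α : ℝ | R ≤ |α|} := measurableSet_le measurable_const (by fun_prop)
  have hmono := integral_mono_of_nonneg (μ := volume.restrict {α : ℝ | R ≤ |α|})
    (f := fun α => ‖S2 η X (l1 * α) * SS η X 3 (l2 * α) * SS η X 3 (l3 * α) *
            SS η X 3 (l4 * α) * SS η X 3 (l5 * α) * SS η X 4 (l6 * α) *
            SS η X k (l7 * α)‖ * Kf τ α)
    (Filter.Eventually.of_forall (fun α => mul_nonneg (norm_nonneg _) (Kf_nonneg _ _)))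
    (j7.const_mul P) (by
      filter_upwards [ae_restrict_mem hms] with α hα
      have hα' : R ≤ |α| := hα
      have hα0 : α ≠ 0 := by
        intro h0; rw [h0, abs_zero] at hα'; linarith
      have hK := Kf_le τ α hα0
      have ham := amgm (‖S2 η X (l1 * α)‖/B1) (‖SS η X 3 (l2 * α)‖/B3) (‖SS η X 3 (l3 * α)‖/B3)
        (‖SS η X 3 (l4 * α)‖/B3) (‖SS η X 3 (l5 * α)‖/B3) (‖SS η X 4 (l6 * α)‖/B4)
        (‖SS η X k (l7 * α)‖/Bk)
      simp only [norm_mul, Pi.add_apply]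
      set s1 := ‖S2 η X (l1 * α)‖
      set s2 := ‖SS η X 3 (l2 * α)‖
      set s3 := ‖SS η X 3 (l3 * α)‖
      set s4 := ‖SS η X 3 (l4 * α)‖
      set s5 := ‖SS η X 3 (l5 * α)‖
      set s6 := ‖SS η X 4 (l6 * α)‖
      set s7 := ‖SS η X k (l7 * α)‖
      calc s1 * s2 * s3 * s4 * s5 * s6 * s7 * Kf τ α
          ≤ s1 * s2 * s3 * s4 * s5 * s6 * s7 * (1/α^2) :=
            mul_le_mul_of_nonneg_left hK (by positivity)
        _ = P * ((s1/B1) * (s2/B3) * (s3/B3) * (s4/B3) * (s5/B3) * (s6/B4) * (s7/Bk)) * (1/α^2) := by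
            rw [hPd]; field_simp
        _ ≤ P * ((s1/B1)^4 + (s2/B3)^8 + (s3/B3)^8 + (s4/B3)^8 + (s5/B3)^8 + (s6/B4)^8
              + (s7/Bk)^8) * (1/α^2) := by gcongr
        _ = _ := by ring)
  refine hmono.trans ?_
  rw [integral_const_mul, integral_add' j6 i7, integral_add' j5 i6, integral_add' j4 i5,
    integral_add' j3 i4, integral_add' j2 i3, integral_add' i1 i2]
  calc _ ≤ P * (C1/R + C2/R + C3/R + C4/R + C5/R + C6/R + C7/R) := by
        apply mul_le_mul_of_nonneg_left _ hP0.le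
        linarith
    _ = _ := by ring
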